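/- arXiv:cond-mat/0004330 — 2 statements merged into one kernel-verified Lean document; each statement's English description precedes it below -/
import Mathlib

section
/- Let q and n be natural numbers with n ≥ 1, and let G be the 5×n square-lattice strip with periodic transverse boundary conditions, i.e. the box product of the cycle graph on 5 vertices with the path graph on n vertices. Let T be the 2×2 integer matrix T = [[q⁵−10q⁴+45q³−115q²+169q−116, 5q⁴−45q³+170q²−315q+235],[q²−6q+10, q³−9q²+29q−32]] (with q cast to ℤ). Then the number of proper q-colorings of G equals q·(q−1)·(q−2)·(uᵀ·T^{n−1}·v), where u is the column vector (q²−2q+2, 5q−5) and v is the column vector (1, 0). -/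
open Matrix

section ProperColorings

variable {α : Type*} [Fintype α] [DecidableEq α]

/-- Indicator of `a ≠ b`, with values in `ℤ`. -/
def differ (a b : α) : ℤ := if a = b then 0 else 1

omit [Fintype α] in
@[simp] theorem differ_self (a : α) : differ a a = 0 := by simp [differ]

omit [Fintype α] in
theorem differ_comm (a b : α) : differ a b = differ b a := by simp [differ, eq_comm]

omit [Fintype α] in
theorem differ_of_ne {a b : α} (h : a ≠ b) : differ a b = 1 := by simp [differ, h]

theorem sum_differ_mul (c : α) (F : α → ℤ) :
    ∑ x, differ c x * F x = ∑ x, F x - F c := by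
  have h : ∀ x, differ c x * F x = F x - if c = x then F x else 0 := by
    intro x; unfold differ; split_ifs <;> simp
  simp [h, Finset.sum_sub_distrib]

theorem sum_differ_mul_sub (c : α) (s : ℤ) (F : α → ℤ) :
    ∑ x, differ c x * (s - F x) = (Fintype.card α - 1) * s - ∑ x, F x + F c := by
  rw [sum_differ_mul]; simp [Finset.sum_sub_distrib]; ring

theorem sum_differ_mul_differ (a b : α) :
    ∑ x, differ a x * differ b x = Fintype.card α - 1 - differ a b := by
  have := sum_differ_mul_sub a 0 (fun x => - differ b x)
  have h := sum_differ_mul b (fun _ => (1 : ℤ))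
  simp at h
  simp [h] at this
  rw [this, differ_comm b a]; ring

theorem sum_fin_succ_arrow {β : Type*} [Fintype β] (n : ℕ) (F : (Fin (n + 1) → β) → ℤ) :
    ∑ f, F f = ∑ a, ∑ g : Fin n → β, F (Fin.cons a g) := by
  rw [← (Fin.consEquiv fun _ => β).sum_comp, Fintype.sum_prod_type]
  rfl

omit [DecidableEq α] in
theorem sum_fin_five_arrow (F : (Fin 5 → α) → ℤ) :
    ∑ f, F f = ∑ a, ∑ b, ∑ c, ∑ d, ∑ e, F ![a, b, c, d, e] := by
  simp only [sum_fin_succ_arrow, Fintype.sum_unique]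
  rfl

/-- Sum of a function that is constant away from a proper coloring of the 5-cycle. -/
theorem sum_of_const_off_five {q : ℤ} (hq : q = Fintype.card α) (c₀ c₁ c₂ c₃ c₄ : α)
    (h01 : c₀ ≠ c₁) (h12 : c₁ ≠ c₂) (h23 : c₂ ≠ c₃) (h34 : c₃ ≠ c₄) (h40 : c₄ ≠ c₀)
    (G : α → ℤ) (g : ℤ)
    (h : ∀ x, x ≠ c₀ → x ≠ c₁ → x ≠ c₂ → x ≠ c₃ → x ≠ c₄ → G x = g) :
    ∑ x, G x = q * g + (G c₀ - g) + (G c₁ - g) + differ c₀ c₂ * (G c₂ - g)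
      + differ c₀ c₃ * differ c₁ c₃ * (G c₃ - g) + differ c₁ c₄ * differ c₂ c₄ * (G c₄ - g) := by
  have key : ∀ x, G x = g + (if x = c₀ then G c₀ - g else 0) + (if x = c₁ then G c₁ - g else 0)
      + (if x = c₂ then differ c₀ c₂ * (G c₂ - g) else 0)
      + (if x = c₃ then differ c₀ c₃ * differ c₁ c₃ * (G c₃ - g) else 0)
      + (if x = c₄ then differ c₁ c₄ * differ c₂ c₄ * (G c₄ - g) else 0) := by
    intro x
    unfold differ
    grind
  rw [Finset.sum_congr rfl fun x _ => key x]
  simp [Finset.sum_add_distrib, hq]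

/-- Weighted number of proper colorings `x₁, …, xₖ` of a path avoiding the colors in the list
positionwise, with `x₁ ≠ y` and `xₖ ≠ a` (for the empty list, `a ≠ y`). -/
def walk (a : α) : List α → α → ℤ
  | [], y => differ a y
  | c :: l, y => ∑ x, differ c x * (differ y x * walk a l x)

/-- The number of colorings counted by `walk` when `x₁` is unconstrained by its left neighbor. -/
def walkTotal (a : α) : List α → ℤ
  | [] => 1
  | c :: l => ∑ x, differ c x * walk a l x

theorem sum_differ (c : α) : ∑ x, differ c x = (Fintype.card α - 1 : ℤ) := by
  simpa using sum_differ_mul c fun _ => 1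

theorem sum_walk (a : α) (l : List α) :
    ∑ x, walk a l x = (Fintype.card α - 1) * walkTotal a l := by
  cases l with
  | nil => simp [walk, walkTotal, sum_differ]
  | cons c l =>
    simp only [walk, walkTotal]
    rw [Finset.sum_comm, Finset.mul_sum]
    refine Finset.sum_congr rfl fun x _ => ?_
    rw [← Finset.mul_sum, ← Finset.sum_mul]
    simp only [differ_comm _ x, sum_differ]
    ring

theorem walk_nil (a y : α) : walk a [] y = differ y a := differ_comm a y

theorem walkTotal_nil (a : α) : walkTotal a [] = 1 := rfl

theorem walkTotal_cons (a c : α) (l : List α) :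
    walkTotal a (c :: l) = (Fintype.card α - 1) * walkTotal a l - walk a l c := by
  rw [walkTotal, sum_differ_mul, sum_walk]

theorem walk_cons (a c : α) (l : List α) (y : α) :
    walk a (c :: l) y = walkTotal a (c :: l) - differ c y * walk a l y := by
  simp only [walk, walkTotal, mul_left_comm (differ c _)]
  rw [sum_differ_mul]

/-- Indicator that `x` is a proper coloring of the 5-cycle. -/
def rowWeight (x : Fin 5 → α) : ℤ := ∏ i, differ (x i) (x (i + 1))

/-- Indicator that the rows `c` and `x` differ at every position. -/
def compatWeight (c x : Fin 5 → α) : ℤ := ∏ i, differ (c i) (x i)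

/-- The number of monochromatic diagonals of the pentagon under the coloring `x`. -/
def chords (x : Fin 5 → α) : ℤ := ∑ i, (1 - differ (x i) (x (i + 2)))

theorem sum_closed (c₀ c₁ c₂ c₃ c₄ : α) :
    ∑ x, compatWeight ![c₀, c₁, c₂, c₃, c₄] x * rowWeight x =
      ∑ x, differ c₀ x * walk x [c₁, c₂, c₃, c₄] x := by
  simp only [sum_fin_five_arrow, walk, Finset.mul_sum]
  refine Finset.sum_congr rfl fun x₀ _ => Finset.sum_congr rfl fun x₁ _ =>
    Finset.sum_congr rfl fun x₂ _ => Finset.sum_congr rfl fun x₃ _ =>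
    Finset.sum_congr rfl fun x₄ _ => ?_
  simp [compatWeight, rowWeight, Fin.prod_univ_five, differ_comm x₄ x₀]
  ring

theorem sum_closed_chord (c₀ c₁ c₂ c₃ c₄ : α) :
    ∑ x, compatWeight ![c₀, c₁, c₂, c₃, c₄] x * rowWeight x * (1 - differ (x 0) (x 2)) =
      ∑ x, differ c₀ x * (differ c₂ x * (walk x [c₁] x * walk x [c₃, c₄] x)) := by
  simp only [sum_fin_five_arrow, walk, Finset.sum_mul]
  simp only [Finset.mul_sum]
  refine Finset.sum_congr rfl fun x₀ _ => ?_
  rw [Finset.sum_comm, Finset.sum_eq_single x₀]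
  · refine Finset.sum_congr rfl fun x₁ _ =>
      Finset.sum_congr rfl fun x₃ _ => Finset.sum_congr rfl fun x₄ _ => ?_
    simp [compatWeight, rowWeight, Fin.prod_univ_five, differ_comm x₄ x₀, differ_comm x₁ x₀]
    ring
  · intro b _ hb
    simp [differ_of_ne hb.symm]
  · simp

omit [Fintype α] in
theorem differ_eq_zero_or_one (a b : α) : differ a b = 0 ∨ differ a b = 1 := by
  unfold differ; split_ifs <;> simp

omit [Fintype α] in
theorem differ_mul_differ_eq {a b c : α} (h : b ≠ c) :
    (1 - differ a b) * (1 - differ a c) = 0 := by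
  unfold differ; grind

set_option linter.unusedSimpArgs false in
theorem sum_closed_eq (c₀ c₁ c₂ c₃ c₄ : α) (h01 : c₀ ≠ c₁) (h12 : c₁ ≠ c₂) (h23 : c₂ ≠ c₃)
    (h34 : c₃ ≠ c₄) (h40 : c₄ ≠ c₀) (q : ℤ) (hq : q = Fintype.card α) :
    ∑ x, differ c₀ x * walk x [c₁, c₂, c₃, c₄] x =
      (q^5 - 10*q^4 + 45*q^3 - 115*q^2 + 169*q - 116) + (q^2 - 6*q + 10) *
      (5 - differ c₀ c₂ - differ c₁ c₃ - differ c₂ c₄ - differ c₀ c₃ - differ c₁ c₄) := by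
  rw [sum_of_const_off_five hq c₀ c₁ c₂ c₃ c₄ h01 h12 h23 h34 h40 _
    ((q - 3) * (q^3 - 6*q^2 + 14*q - 12 - differ c₂ c₄) + (2*q^2 - 9*q + 12)
      - differ c₁ c₃ * (q - 2 - differ c₁ c₄))]
  · simp only [walk_cons, walkTotal_cons, walkTotal_nil, walk_nil, ← hq,
      differ_self, differ_comm c₁ c₀, differ_comm c₂ c₀, differ_comm c₃ c₀,
      differ_comm c₄ c₀, differ_comm c₂ c₁, differ_comm c₃ c₁, differ_comm c₄ c₁,
      differ_comm c₃ c₂, differ_comm c₄ c₂, differ_comm c₄ c₃, differ_of_ne h01,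
      differ_of_ne h12, differ_of_ne h23, differ_of_ne h34, differ_of_ne h40.symm]
    have h1 := differ_mul_differ_eq (a := c₀) h23
    have h2 := differ_mul_differ_eq (a := c₁) h34
    have h3 := differ_mul_differ_eq (a := c₂) h40
    have h4 := differ_mul_differ_eq (a := c₃) h01
    have h5 := differ_mul_differ_eq (a := c₄) h12
    simp only [differ_self, differ_comm c₁ c₀, differ_comm c₂ c₀, differ_comm c₃ c₀,
      differ_comm c₄ c₀, differ_comm c₂ c₁, differ_comm c₃ c₁, differ_comm c₄ c₁,
      differ_comm c₃ c₂, differ_comm c₄ c₂, differ_comm c₄ c₃, differ_of_ne h01,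
      differ_of_ne h12, differ_of_ne h23, differ_of_ne h34, differ_of_ne h40.symm] at h1 h2 h3 h4 h5
    rcases differ_eq_zero_or_one c₀ c₂ with ha | ha <;>
    rcases differ_eq_zero_or_one c₁ c₃ with hb | hb <;>
    rcases differ_eq_zero_or_one c₂ c₄ with hc | hc <;>
    rcases differ_eq_zero_or_one c₀ c₃ with hd | hd <;>
    rcases differ_eq_zero_or_one c₁ c₄ with he | he <;>
    simp only [ha, hb, hc, hd, he] at h1 h2 h3 h4 h5 ⊢ <;>
    first | omega | ring
  · intro x h0 h1 h2 h3 h4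
    simp only [walk_cons, walkTotal_cons, walkTotal_nil, walk_nil, ← hq,
      differ_self, differ_comm c₁ c₀, differ_comm c₂ c₀, differ_comm c₃ c₀,
      differ_comm c₄ c₀, differ_comm c₂ c₁, differ_comm c₃ c₁, differ_comm c₄ c₁,
      differ_comm c₃ c₂, differ_comm c₄ c₂, differ_comm c₄ c₃, differ_of_ne h01,
      differ_of_ne h12, differ_of_ne h23, differ_of_ne h34, differ_of_ne h40.symm,
      differ_of_ne h0.symm, differ_of_ne h1.symm, differ_of_ne h2.symm,
      differ_of_ne h3.symm, differ_of_ne h4.symm]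
    ring

set_option linter.unusedSimpArgs false in
theorem sum_closed_chord_eq (c₀ c₁ c₂ c₃ c₄ : α) (h01 : c₀ ≠ c₁) (h12 : c₁ ≠ c₂) (h23 : c₂ ≠ c₃)
    (h34 : c₃ ≠ c₄) (h40 : c₄ ≠ c₀) (q : ℤ) (hq : q = Fintype.card α) :
    ∑ x, differ c₀ x * (differ c₂ x * (walk x [c₁] x * walk x [c₃, c₄] x)) =
      (q^4 - 9*q^3 + 34*q^2 - 63*q + 47) + (q^3 - 7*q^2 + 17*q - 14) * (1 - differ c₀ c₂)
        + (q - 3) * (2 - differ c₁ c₃ - differ c₁ c₄)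
        - (q^2 - 5*q + 6) * (2 - differ c₂ c₄ - differ c₀ c₃) := by
  rw [sum_of_const_off_five hq c₀ c₁ c₂ c₃ c₄ h01 h12 h23 h34 h40 _
    ((q - 2) * (q^2 - 5*q + 7))]
  · simp only [walk_cons, walkTotal_cons, walkTotal_nil, walk_nil, ← hq,
      differ_self, differ_comm c₁ c₀, differ_comm c₂ c₀, differ_comm c₃ c₀,
      differ_comm c₄ c₀, differ_comm c₂ c₁, differ_comm c₃ c₁, differ_comm c₄ c₁,
      differ_comm c₃ c₂, differ_comm c₄ c₂, differ_comm c₄ c₃, differ_of_ne h01,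
      differ_of_ne h12, differ_of_ne h23, differ_of_ne h34, differ_of_ne h40.symm]
    have h1 := differ_mul_differ_eq (a := c₀) h23
    have h2 := differ_mul_differ_eq (a := c₁) h34
    have h3 := differ_mul_differ_eq (a := c₂) h40
    have h4 := differ_mul_differ_eq (a := c₃) h01
    have h5 := differ_mul_differ_eq (a := c₄) h12
    simp only [differ_self, differ_comm c₁ c₀, differ_comm c₂ c₀, differ_comm c₃ c₀,
      differ_comm c₄ c₀, differ_comm c₂ c₁, differ_comm c₃ c₁, differ_comm c₄ c₁,
      differ_comm c₃ c₂, differ_comm c₄ c₂, differ_comm c₄ c₃, differ_of_ne h01,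
      differ_of_ne h12, differ_of_ne h23, differ_of_ne h34, differ_of_ne h40.symm] at h1 h2 h3 h4 h5
    rcases differ_eq_zero_or_one c₀ c₂ with ha | ha <;>
    rcases differ_eq_zero_or_one c₁ c₃ with hb | hb <;>
    rcases differ_eq_zero_or_one c₂ c₄ with hc | hc <;>
    rcases differ_eq_zero_or_one c₀ c₃ with hd | hd <;>
    rcases differ_eq_zero_or_one c₁ c₄ with he | he <;>
    simp only [ha, hb, hc, hd, he] at h1 h2 h3 h4 h5 ⊢ <;>
    first | omega | ring
  · intro x h0 h1 h2 h3 h4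
    simp only [walk_cons, walkTotal_cons, walkTotal_nil, walk_nil, ← hq,
      differ_self, differ_comm c₁ c₀, differ_comm c₂ c₀, differ_comm c₃ c₀,
      differ_comm c₄ c₀, differ_comm c₂ c₁, differ_comm c₃ c₁, differ_comm c₄ c₁,
      differ_comm c₃ c₂, differ_comm c₄ c₂, differ_comm c₄ c₃, differ_of_ne h01,
      differ_of_ne h12, differ_of_ne h23, differ_of_ne h34, differ_of_ne h40.symm,
      differ_of_ne h0.symm, differ_of_ne h1.symm, differ_of_ne h2.symm,
      differ_of_ne h3.symm, differ_of_ne h4.symm]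
    ring

omit [Fintype α] in
theorem rowWeight_eq_ite (x : Fin 5 → α) :
    rowWeight x = if ∀ i, x i ≠ x (i + 1) then 1 else 0 := by
  have h : ∀ i, differ (x i) (x (i + 1)) = if x i ≠ x (i + 1) then 1 else 0 := fun i => by
    simp [differ]
  simp only [rowWeight, h, Finset.prod_ite_zero, Finset.mem_univ, forall_const,
    Finset.prod_const_one]

omit [Fintype α] in
theorem compatWeight_eq_ite (c x : Fin 5 → α) :
    compatWeight c x = if ∀ i, c i ≠ x i then 1 else 0 := by
  have h : ∀ i, differ (c i) (x i) = if c i ≠ x i then 1 else 0 := fun i => by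
    simp [differ]
  simp only [compatWeight, h, Finset.prod_ite_zero, Finset.mem_univ, forall_const,
    Finset.prod_const_one]

omit [Fintype α] in
theorem rowWeight_rotate (x : Fin 5 → α) (k : Fin 5) :
    rowWeight (fun i => x (i + k)) = rowWeight x := by
  unfold rowWeight
  rw [← Equiv.prod_comp (Equiv.addRight k) fun i => differ (x i) (x (i + 1))]
  simp [add_right_comm]

omit [Fintype α] in
theorem compatWeight_rotate (c x : Fin 5 → α) (k : Fin 5) :
    compatWeight (fun i => c (i + k)) (fun i => x (i + k)) = compatWeight c x := by
  unfold compatWeight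
  rw [← Equiv.prod_comp (Equiv.addRight k) fun i => differ (c i) (x i)]
  rfl

theorem sum_rotate {β : Type*} [Fintype β] (F : (Fin 5 → β) → ℤ) (k : Fin 5) :
    ∑ x : Fin 5 → β, F (fun i => x (i + k)) = ∑ x, F x :=
  ((Equiv.addRight k).symm.arrowCongr (Equiv.refl β)).sum_comp F

theorem sum_compat_row (c : Fin 5 → α) (hc : ∀ i, c i ≠ c (i + 1)) (q : ℤ)
    (hq : q = Fintype.card α) :
    ∑ x, compatWeight c x * rowWeight x =
      (q^5 - 10*q^4 + 45*q^3 - 115*q^2 + 169*q - 116) + (q^2 - 6*q + 10) * chords c := by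
  have e : c = ![c 0, c 1, c 2, c 3, c 4] := by
    ext i; fin_cases i <;> rfl
  have h := sum_closed (c 0) (c 1) (c 2) (c 3) (c 4)
  rw [← e] at h
  rw [h, sum_closed_eq (c 0) (c 1) (c 2) (c 3) (c 4) (hc 0) (hc 1) (hc 2) (hc 3) (hc 4) q hq]
  have hch : chords c = 5 - differ (c 0) (c 2) - differ (c 1) (c 3) - differ (c 2) (c 4)
      - differ (c 0) (c 3) - differ (c 1) (c 4) := by
    simp [chords, Fin.sum_univ_five, differ_comm (c 3) (c 0), differ_comm (c 4) (c 1)]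
    ring
  rw [hch]

theorem sum_compat_row_chord (c : Fin 5 → α) (hc : ∀ i, c i ≠ c (i + 1)) (q : ℤ)
    (hq : q = Fintype.card α) :
    ∑ x, compatWeight c x * rowWeight x * (1 - differ (x 0) (x 2)) =
      (q^4 - 9*q^3 + 34*q^2 - 63*q + 47) + (q^3 - 7*q^2 + 17*q - 14) * (1 - differ (c 0) (c 2))
        + (q - 3) * (2 - differ (c 1) (c 3) - differ (c 4) (c 1))
        - (q^2 - 5*q + 6) * (2 - differ (c 2) (c 4) - differ (c 3) (c 0)) := by
  have e : c = ![c 0, c 1, c 2, c 3, c 4] := by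
    ext i; fin_cases i <;> rfl
  have h := sum_closed_chord (c 0) (c 1) (c 2) (c 3) (c 4)
  rw [← e] at h
  rw [h, sum_closed_chord_eq (c 0) (c 1) (c 2) (c 3) (c 4) (hc 0) (hc 1) (hc 2) (hc 3) (hc 4) q hq,
    differ_comm (c 3) (c 0), differ_comm (c 4) (c 1)]

theorem sum_compat_row_chords (c : Fin 5 → α) (hc : ∀ i, c i ≠ c (i + 1)) (q : ℤ)
    (hq : q = Fintype.card α) :
    ∑ x, compatWeight c x * rowWeight x * chords x =
      (5*q^4 - 45*q^3 + 170*q^2 - 315*q + 235) + (q^3 - 9*q^2 + 29*q - 32) * chords c := by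
  have h (k : Fin 5) : ∑ x, compatWeight c x * rowWeight x * (1 - differ (x k) (x (k + 2))) =
      ∑ x, compatWeight (fun i => c (i + k)) x * rowWeight x * (1 - differ (x 0) (x 2)) := by
    rw [← sum_rotate (fun x => compatWeight (fun i => c (i + k)) x * rowWeight x *
      (1 - differ (x 0) (x 2))) k]
    simp only [compatWeight_rotate, rowWeight_rotate, zero_add, add_comm 2 k]
  have hr (k : Fin 5) := sum_compat_row_chord (fun i => c (i + k))
    (fun i => by rw [add_right_comm]; exact hc _) q hq
  simp only [chords, Finset.mul_sum]
  rw [Finset.sum_comm]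
  simp only [h, hr, Fin.sum_univ_five]
  simp
  ring

theorem sum_differ_right (c : α) : ∑ x, differ x c = (Fintype.card α - 1 : ℤ) := by
  simp only [differ_comm _ c, sum_differ]

theorem sum_differ_mul_sub_differ (a b : α) (s : ℤ) :
    ∑ x, differ a x * (s - differ x b) =
      (Fintype.card α - 1) * (s - 1) + differ a b := by
  rw [sum_differ_mul_sub, sum_differ_right]; ring

theorem sum_row (q : ℤ) (hq : q = Fintype.card α) :
    ∑ x : Fin 5 → α, rowWeight x = q * (q - 1) * (q - 2) * (q^2 - 2*q + 2) := by
  have h : ∑ x : Fin 5 → α, rowWeight x = ∑ a : α, ∑ b, differ a b * ∑ c, differ b c *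
      ∑ d, differ c d * ∑ e, differ d e * differ e a := by
    simp only [sum_fin_five_arrow, Finset.mul_sum]
    simp [rowWeight, Fin.prod_univ_five, mul_assoc]
  have e4 (a b : α) : ∑ e, differ b e * differ e a = q - 1 - differ b a := by
    simp only [differ_comm _ a, sum_differ_mul_differ, hq]
  have e3 (a b : α) : ∑ e, differ b e * (q - 1 - differ e a) = (q - 1) * (q - 2) + differ b a := by
    rw [sum_differ_mul_sub_differ, ← hq]; ring
  have e2 (a b : α) : ∑ e, differ b e * ((q - 1) * (q - 2) + differ e a) =
      ((q - 1) * ((q - 1) * (q - 2) + 1) - differ b a) := by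
    simp only [mul_add, Finset.sum_add_distrib, e4, ← Finset.sum_mul, sum_differ, ← hq]; ring
  rw [h]
  simp only [e4, e3, e2, sum_differ_mul_sub_differ, ← hq, differ_self, Finset.sum_const,
    Finset.card_univ, nsmul_eq_mul]
  ring

theorem sum_row_chord (q : ℤ) (hq : q = Fintype.card α) :
    ∑ x : Fin 5 → α, rowWeight x * (1 - differ (x 0) (x 2)) = q * (q - 1) * (q - 2) * (q - 1) := by
  have h : ∑ x : Fin 5 → α, rowWeight x * (1 - differ (x 0) (x 2)) =
      ∑ a : α, (∑ b, differ a b * differ a b) * ∑ d, differ a d * ∑ e, differ d e * differ e a := by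
    simp only [sum_fin_five_arrow, Finset.sum_mul]
    simp only [Finset.mul_sum]
    refine Finset.sum_congr rfl fun a _ => Finset.sum_congr rfl fun b _ => ?_
    rw [Finset.sum_eq_single a]
    · simp [rowWeight, Fin.prod_univ_five, differ_comm b a, mul_assoc]
    · intro x _ hx
      simp [differ_of_ne hx.symm]
    · simp
  have e4 (a b : α) : ∑ e, differ b e * differ e a = q - 1 - differ b a := by
    simp only [differ_comm _ a, sum_differ_mul_differ, hq]
  rw [h]
  simp only [e4, sum_differ_mul_differ, sum_differ_mul_sub_differ, ← hq, differ_self,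
    Finset.sum_const, Finset.card_univ, nsmul_eq_mul]
  ring

theorem sum_row_chords (q : ℤ) (hq : q = Fintype.card α) :
    ∑ x : Fin 5 → α, rowWeight x * chords x = q * (q - 1) * (q - 2) * (5*q - 5) := by
  have h (k : Fin 5) : ∑ x : Fin 5 → α, rowWeight x * (1 - differ (x k) (x (k + 2))) =
      q * (q - 1) * (q - 2) * (q - 1) := by
    rw [← sum_row_chord q hq,
      ← sum_rotate (fun x : Fin 5 → α => rowWeight x * (1 - differ (x 0) (x 2))) k]
    simp only [rowWeight_rotate, zero_add, add_comm 2 k]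
  simp only [chords, Finset.mul_sum]
  rw [Finset.sum_comm]
  simp only [h, Finset.sum_const, Finset.card_univ, Fintype.card_fin, nsmul_eq_mul]
  push_cast
  ring

/-- Weighted count of the ways to extend a proper first row `c` by `m` further rows. -/
theorem sum_strip (q : ℤ) (hq : q = Fintype.card α) (T : Matrix (Fin 2) (Fin 2) ℤ)
    (hT : T = !![q^5 - 10*q^4 + 45*q^3 - 115*q^2 + 169*q - 116,
      5*q^4 - 45*q^3 + 170*q^2 - 315*q + 235; q^2 - 6*q + 10, q^3 - 9*q^2 + 29*q - 32])
    (m : ℕ) (c : Fin 5 → α) (hc : ∀ i, c i ≠ c (i + 1)) :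
    ∑ g : Fin m → Fin 5 → α, ∏ i : Fin m,
        (compatWeight ((Fin.cons c g : Fin (m + 1) → Fin 5 → α) i.castSucc) (g i)
          * rowWeight (g i)) =
      ((T ^ m) *ᵥ ![1, 0]) 0 + ((T ^ m) *ᵥ ![1, 0]) 1 * chords c := by
  induction m generalizing c with
  | zero => simp
  | succ m ih =>
    have hs : ∀ d : Fin 5 → α, ∑ g : Fin m → Fin 5 → α, ∏ i : Fin (m + 1),
        (compatWeight ((Fin.cons c (Fin.cons d g : Fin (m + 1) → Fin 5 → α) :
            Fin (m + 2) → Fin 5 → α) i.castSucc) ((Fin.cons d g : Fin (m + 1) → Fin 5 → α) i)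
          * rowWeight ((Fin.cons d g : Fin (m + 1) → Fin 5 → α) i)) =
        ((T ^ m) *ᵥ ![1, 0]) 0 * (compatWeight c d * rowWeight d) +
        ((T ^ m) *ᵥ ![1, 0]) 1 * (compatWeight c d * rowWeight d * chords d) := by
      intro d
      simp only [Fin.prod_univ_succ, Fin.castSucc_zero, Fin.cons_zero, Fin.cons_succ,
        ← Fin.succ_castSucc, ← Finset.mul_sum]
      by_cases hd : ∀ i, d i ≠ d (i + 1)
      · rw [ih d hd]; ring
      · simp [rowWeight_eq_ite d, hd]
    rw [sum_fin_succ_arrow, Finset.sum_congr rfl fun d _ => hs d, Finset.sum_add_distrib,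
      ← Finset.mul_sum, ← Finset.mul_sum, sum_compat_row c hc q hq, sum_compat_row_chords c hc q hq,
      pow_succ' T, ← Matrix.mulVec_mulVec]
    generalize (T ^ m) *ᵥ ![1, 0] = v
    rw [hT]
    simp [Matrix.mulVec, dotProduct, Fin.sum_univ_two]
    ring

end ProperColorings

theorem cycle_strip_proper_iff {q m : ℕ} (f : Fin 5 × Fin (m + 1) → Fin q) :
    (∀ a b, ((SimpleGraph.cycleGraph 5).boxProd (SimpleGraph.pathGraph (m + 1))).Adj a b →
      f a ≠ f b) ↔
    (∀ j i, f (i, j) ≠ f (i + 1, j)) ∧ ∀ (j : Fin m) i, f (i, j.castSucc) ≠ f (i, j.succ) := by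
  simp only [SimpleGraph.boxProd_adj, SimpleGraph.cycleGraph_adj, SimpleGraph.pathGraph_adj]
  constructor
  · refine fun h => ⟨fun j i => h _ _ (.inl ⟨.inr ?_, rfl⟩), fun j i => h _ _ (.inr ⟨.inl ?_, rfl⟩)⟩
    · simp
    · simp
  · rintro ⟨h₁, h₂⟩ ⟨i, j⟩ ⟨i', j'⟩ (⟨h | h, rfl : j = j'⟩ | ⟨h | h, rfl : i = i'⟩)
    · obtain rfl : i = i' + 1 := by rw [← h]; simp
      exact (h₁ j i').symm
    · obtain rfl : i' = i + 1 := by rw [← h]; simp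
      exact h₁ j i
    · obtain ⟨k, rfl⟩ : ∃ k : Fin m, k.castSucc = j := ⟨⟨j, by grind⟩, rfl⟩
      obtain rfl : j' = k.succ := Fin.ext h.symm
      exact h₂ k i
    · obtain ⟨k, rfl⟩ : ∃ k : Fin m, k.castSucc = j' := ⟨⟨j', by grind⟩, rfl⟩
      obtain rfl : j = k.succ := Fin.ext h.symm
      exact (h₂ k i).symm

theorem card_cycle_strip (q m : ℕ) :
    (Nat.card {f : Fin 5 × Fin (m + 1) → Fin q //
        ∀ a b, ((SimpleGraph.cycleGraph 5).boxProd (SimpleGraph.pathGraph (m + 1))).Adj a b →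
          f a ≠ f b} : ℤ) =
      ∑ c : Fin 5 → Fin q, rowWeight c * ∑ g : Fin m → Fin 5 → Fin q, ∏ i : Fin m,
        (compatWeight ((Fin.cons c g : Fin (m + 1) → Fin 5 → Fin q) i.castSucc) (g i)
          * rowWeight (g i)) := by
  classical
  simp only [cycle_strip_proper_iff, Finset.mul_sum]
  rw [Nat.card_eq_fintype_card, Fintype.card_subtype, Finset.card_filter]
  push_cast
  let e : (Fin (m + 1) → Fin 5 → Fin q) ≃ (Fin 5 × Fin (m + 1) → Fin q) :=
    (Equiv.curry _ _ _).symm.trans ((Equiv.prodComm _ _).arrowCongr (Equiv.refl _))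
  rw [← e.sum_comp, sum_fin_succ_arrow]
  refine Finset.sum_congr rfl fun c _ => Finset.sum_congr rfl fun g _ => ?_
  have he : ∀ h i j, e h (i, j) = h j i := fun _ _ _ => rfl
  simp only [he, rowWeight_eq_ite, compatWeight_eq_ite, Fin.forall_fin_succ (n := m), Fin.cons_zero,
    Fin.cons_succ, ← ite_and, mul_ite, mul_one, mul_zero, Finset.prod_ite_zero,
    Finset.prod_const_one, Finset.mem_univ, forall_const]
  refine if_congr ?_ rfl rfl
  grind

/-- Transfer-matrix formula for the chromatic polynomial of the `5 × n` square-lattice strip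
with periodic transverse boundary conditions (`C₅ □ Pₙ`): the number of proper `q`-colorings
equals `q (q-1) (q-2) · uᵀ T^{n-1} v` with the indicated `2 × 2` transfer matrix `T` and
vectors `u = (q² - 2q + 2, 5q - 5)`, `v = (1, 0)`. -/
theorem chromatic_polynomial_square_strip_5P
    (q n : ℕ) (hn : 1 ≤ n) :
    (Nat.card {f : Fin 5 × Fin n → Fin q //
        ∀ a b, ((SimpleGraph.cycleGraph 5).boxProd (SimpleGraph.pathGraph n)).Adj a b →
          f a ≠ f b} : ℤ) =
      (q : ℤ) * ((q : ℤ) - 1) * ((q : ℤ) - 2) *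
        (![(q : ℤ)^2 - 2*(q : ℤ) + 2, 5*(q : ℤ) - 5] ⬝ᵥ
          ((!![(q : ℤ)^5 - 10*(q : ℤ)^4 + 45*(q : ℤ)^3 - 115*(q : ℤ)^2 + 169*(q : ℤ) - 116,
               5*(q : ℤ)^4 - 45*(q : ℤ)^3 + 170*(q : ℤ)^2 - 315*(q : ℤ) + 235;
               (q : ℤ)^2 - 6*(q : ℤ) + 10,
               (q : ℤ)^3 - 9*(q : ℤ)^2 + 29*(q : ℤ) - 32]) ^ (n - 1)).mulVec ![1, 0]) := by
  obtain ⟨m, rfl⟩ := Nat.exists_eq_add_of_le' hn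
  have hq : (q : ℤ) = Fintype.card (Fin q) := by simp
  rw [card_cycle_strip, Nat.add_sub_cancel]
  generalize hT : (!![_, _; _, _] : Matrix (Fin 2) (Fin 2) ℤ) = T
  have h (c : Fin 5 → Fin q) : rowWeight c * ∑ g : Fin m → Fin 5 → Fin q, ∏ i : Fin m,
        (compatWeight ((Fin.cons c g : Fin (m + 1) → Fin 5 → Fin q) i.castSucc) (g i)
          * rowWeight (g i)) = ((T ^ m) *ᵥ ![1, 0]) 0 * rowWeight c
        + ((T ^ m) *ᵥ ![1, 0]) 1 * (rowWeight c * chords c) := by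
    by_cases hc : ∀ i, c i ≠ c (i + 1)
    · rw [sum_strip q hq T hT.symm m c hc]; ring
    · simp [rowWeight_eq_ite c, hc]
  rw [Finset.sum_congr rfl fun c _ => h c, Finset.sum_add_distrib, ← Finset.mul_sum,
    ← Finset.mul_sum, sum_row q hq, sum_row_chords q hq]
  simp [dotProduct, Fin.sum_univ_two]
  ring
end

section
/- For every natural number m ≥ 1, the number of non-crossing partitions of the set {0, 1, …, m−1} in which no block contains two consecutive integers equals the Motzkin number M_{m−1} = Σ_{j=0}^{⌊(m−1)/2⌋} binom(m−1, 2j)·C_j, where C_j is the j-th Catalan number. -/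
/-- A finite partition of `{0,…,m-1}` is non-crossing if whenever `a < b < c < d` with
`a, c` in one block and `b, d` in one block, all four lie in a common block. -/
def Finpartition.IsNoncrossing {m : ℕ}
    (P : Finpartition (Finset.univ : Finset (Fin m))) : Prop :=
  ∀ a b c d : Fin m, a < b → b < c → c < d →
    (∃ B ∈ P.parts, a ∈ B ∧ c ∈ B) → (∃ B ∈ P.parts, b ∈ B ∧ d ∈ B) →
    ∃ B ∈ P.parts, a ∈ B ∧ b ∈ B ∧ c ∈ B ∧ d ∈ B

/-- A finite partition of `{0,…,m-1}` has no nearest-neighbor pair if no block contains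
two consecutive integers `i` and `i+1`. -/
def Finpartition.NoNearestNeighbor {m : ℕ}
    (P : Finpartition (Finset.univ : Finset (Fin m))) : Prop :=
  ∀ B ∈ P.parts, ∀ i j : Fin m, (i : ℕ) + 1 = (j : ℕ) → ¬(i ∈ B ∧ j ∈ B)

/-- The Motzkin numbers, given by the explicit formula
`M n = ∑_{j=0}^{⌊n/2⌋} (n choose 2j) · C_j`. -/
def motzkin (n : ℕ) : ℕ :=
  ∑ j ∈ Finset.range (n / 2 + 1), Nat.choose n (2 * j) * catalan j

open Finset in
theorem Nat.sum_antidiagonal_choose_mul_choose (n p q : ℕ) :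
    ∑ ij ∈ antidiagonal n, ij.1.choose p * ij.2.choose q = (n + 1).choose (p + q + 1) := by
  induction n generalizing q with
  | zero =>
    rcases p with _ | p <;> rcases q with _ | q <;> simp <;>
      rw [Nat.choose_eq_zero_of_lt (by lia)]
  | succ n ih =>
    rw [Nat.sum_antidiagonal_succ']
    cases q with
    | zero =>
      have := ih 0
      simp only [Nat.choose_zero_right, mul_one, add_zero] at this ⊢
      rw [this, Nat.choose_succ_succ (n + 1)]
    | succ q =>
      simp only [Nat.choose_zero_succ, mul_zero, zero_add, Nat.choose_succ_succ' _ q, mul_add,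
        sum_add_distrib, ih]
      rw [← add_assoc p, Nat.choose_succ_succ' (n + 1)]

section

open Finset

theorem motzkin_eq_sum_range {n N : ℕ} (h : n < 2 * N) :
    motzkin n = ∑ j ∈ range N, n.choose (2 * j) * catalan j := by
  refine sum_subset (range_subset_range.2 (by lia)) fun j _ hj => ?_
  rw [Nat.choose_eq_zero_of_lt (by simp at hj; lia), zero_mul]

theorem motzkin_add_two (n : ℕ) :
    motzkin (n + 2) = motzkin (n + 1) + ∑ ij ∈ antidiagonal n, motzkin ij.1 * motzkin ij.2 := by
  have hconv : ∑ ij ∈ antidiagonal n, motzkin ij.1 * motzkin ij.2 =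
      ∑ a ∈ range (n + 1), ∑ b ∈ range (n + 1),
        (n + 1).choose (2 * (a + b) + 1) * (catalan a * catalan b) := by
    calc
      _ = ∑ ij ∈ antidiagonal n, ∑ a ∈ range (n + 1), ∑ b ∈ range (n + 1),
          (ij.1.choose (2 * a) * ij.2.choose (2 * b)) * (catalan a * catalan b) := by
        refine sum_congr rfl fun ij hij => ?_
        rw [HasAntidiagonal.mem_antidiagonal] at hij
        rw [motzkin_eq_sum_range (n := ij.1) (N := n + 1) (by lia),
          motzkin_eq_sum_range (n := ij.2) (N := n + 1) (by lia), sum_mul_sum]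
        exact sum_congr rfl fun a _ => sum_congr rfl fun b _ => by ring
      _ = _ := by
        rw [sum_comm]
        refine sum_congr rfl fun a _ => ?_
        rw [sum_comm]
        refine sum_congr rfl fun b _ => ?_
        rw [← sum_mul, Nat.sum_antidiagonal_choose_mul_choose, mul_add]
  have hcat : ∑ j ∈ range (n + 1), (n + 1).choose (2 * j + 1) * catalan (j + 1) =
      ∑ a ∈ range (n + 1), ∑ b ∈ range (n + 1),
        (n + 1).choose (2 * (a + b) + 1) * (catalan a * catalan b) := by
    have hl (j) : (n + 1).choose (2 * j + 1) * catalan (j + 1) =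
        ∑ ab ∈ antidiagonal j,
          (n + 1).choose (2 * (ab.1 + ab.2) + 1) * (catalan ab.1 * catalan ab.2) := by
      rw [catalan_succ', mul_sum]
      exact sum_congr rfl fun ab hab => by rw [HasAntidiagonal.mem_antidiagonal.1 hab]
    simp only [hl]
    rw [← sum_product', sum_sigma']
    refine sum_of_injOn (fun x => x.2) ?_ ?_ ?_ fun _ _ => rfl
    · rintro ⟨i, a, b⟩ h1 ⟨j, c, d⟩ h2 h
      simp at h h1 h2
      obtain ⟨rfl, rfl⟩ := h
      obtain rfl : i = j := by lia
      rfl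
    · rintro ⟨i, a, b⟩ h1
      simp at h1 ⊢
      lia
    · rintro ⟨a, b⟩ h1 h2
      rw [Nat.choose_eq_zero_of_lt, zero_mul]
      by_contra hab
      exact h2 ⟨⟨a + b, a, b⟩, by simp; lia, rfl⟩
  rw [hconv, ← hcat, motzkin_eq_sum_range (n := n + 2) (N := n + 2) (by lia),
    motzkin_eq_sum_range (n := n + 1) (N := n + 2) (by lia), sum_range_succ' _ (n + 1),
    sum_range_succ' _ (n + 1)]
  have hpascal (j : ℕ) : (n + 2).choose (2 * (j + 1)) * catalan (j + 1) =
      (n + 1).choose (2 * (j + 1)) * catalan (j + 1) +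
        (n + 1).choose (2 * j + 1) * catalan (j + 1) := by
    rw [← add_mul, mul_add, Nat.choose_succ_succ (n + 1) (2 * j + 1)]
    ring
  simp only [hpascal, sum_add_distrib]
  simp
  ring

end

/-- `r` is the same-block relation of a non-crossing partition of `{l,…,u-1}` in which no block
contains two consecutive integers. -/
structure IsSparseNoncrossing (l u : ℕ) (r : ℕ → ℕ → Prop) : Prop where
  mem : ∀ {i j}, r i j → l ≤ i ∧ i < u
  refl : ∀ {i}, l ≤ i → i < u → r i i
  symm : ∀ {i j}, r i j → r j i
  trans : ∀ {i j k}, r i j → r j k → r i k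
  noncrossing : ∀ {a b c d}, a < b → b < c → c < d → r a c → r b d → r a b
  not_succ : ∀ i, ¬ r i (i + 1)

namespace IsSparseNoncrossing

variable {l k u : ℕ} {r p q : ℕ → ℕ → Prop}

theorem restrict (h : IsSparseNoncrossing l u r) {l' u' : ℕ} (hl : l ≤ l') (hu : u' ≤ u) :
    IsSparseNoncrossing l' u' fun i j => r i j ∧ l' ≤ i ∧ i < u' ∧ l' ≤ j ∧ j < u' where
  mem h' := ⟨h'.2.1, h'.2.2.1⟩
  refl h1 h2 := ⟨h.refl (by lia) (by lia), h1, h2, h1, h2⟩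
  symm h' := ⟨h.symm h'.1, by lia⟩
  trans h1 h2 := ⟨h.trans h1.1 h2.1, by lia⟩
  noncrossing hab hbc hcd h1 h2 := ⟨h.noncrossing hab hbc hcd h1.1 h2.1, by lia⟩
  not_succ i h' := h.not_succ i h'.1

theorem shift (h : IsSparseNoncrossing l u r) {s : ℕ} (hs : s ≤ l) :
    IsSparseNoncrossing (l - s) (u - s) fun i j => r (i + s) (j + s) where
  mem h' := by have := h.mem h'; lia
  refl h1 h2 := h.refl (by lia) (by lia)
  symm h' := h.symm h'
  trans h1 h2 := h.trans h1 h2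
  noncrossing hab hbc hcd h1 h2 :=
    h.noncrossing (by lia) (by lia) (Nat.add_lt_add_right hcd s) h1 h2
  not_succ i h' := h.not_succ (i + s) (by convert h' using 1; lia)

theorem unshift (h : IsSparseNoncrossing l u r) (s : ℕ) :
    IsSparseNoncrossing (l + s) (u + s) fun i j => s ≤ i ∧ s ≤ j ∧ r (i - s) (j - s) where
  mem h' := by have := h.mem h'.2.2; lia
  refl h1 h2 := ⟨by lia, by lia, h.refl (by lia) (by lia)⟩
  symm h' := ⟨h'.2.1, h'.1, h.symm h'.2.2⟩
  trans h1 h2 := ⟨h1.1, h2.2.1, h.trans h1.2.2 h2.2.2⟩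
  noncrossing hab hbc hcd h1 h2 :=
    ⟨h1.1, h2.1, h.noncrossing (c := _ - s) (d := _ - s) (by lia) (by lia) (by lia) h1.2.2 h2.2.2⟩
  not_succ i h' := h.not_succ (i - s) (by convert h'.2.2 using 1; lia)

theorem addSingleton (h : IsSparseNoncrossing (l + 1) u r) (hu : l < u) :
    IsSparseNoncrossing l u fun i j => r i j ∨ i = l ∧ j = l := by
  have hm := @h.mem
  have hs := @h.symm
  have ht := @h.trans
  have hr := @h.refl
  have hn := @h.noncrossing
  have hq := h.not_succ
  constructor <;> grind

theorem glue (hp : IsSparseNoncrossing (l + 1) k p) (hq : IsSparseNoncrossing k u q)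
    (hk : l + 2 ≤ k) (hu : k < u) :
    IsSparseNoncrossing l u fun i j =>
      p i j ∨ q (if i = l then k else i) (if j = l then k else j) := by
  have hm := @hp.mem
  have hs := @hp.symm
  have ht := @hp.trans
  have hr := @hp.refl
  have hn := @hp.noncrossing
  have hz := hp.not_succ
  have hm' := @hq.mem
  have hs' := @hq.symm
  have ht' := @hq.trans
  have hr' := @hq.refl
  have hn' := @hq.noncrossing
  have hz' := hq.not_succ
  constructor
  · grind
  · grind
  · grind
  · grind
  · grind
  · clear hn hn' ht ht' hr hr'
    grind

/-- The least element of `(l, u)` related to `l`, or `u` if there is none. -/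
noncomputable def nextInBlock (l u : ℕ) (r : ℕ → ℕ → Prop) : ℕ :=
  sInf {k | l < k ∧ (k = u ∨ r l k)}

theorem nextInBlock_mem (r : ℕ → ℕ → Prop) (hu : l < u) :
    l < nextInBlock l u r ∧ (nextInBlock l u r = u ∨ r l (nextInBlock l u r)) :=
  Nat.sInf_mem (s := {k | l < k ∧ (k = u ∨ r l k)}) ⟨u, hu, .inl rfl⟩

theorem nextInBlock_le (r : ℕ → ℕ → Prop) (hk : l < k) (h : k = u ∨ r l k) :
    nextInBlock l u r ≤ k :=
  Nat.sInf_le ⟨hk, h⟩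

theorem nextInBlock_eq_iff (r : ℕ → ℕ → Prop) (hk : l < k) (hu : k < u) :
    nextInBlock l u r = k ↔ r l k ∧ ∀ i, l < i → i < k → ¬ r l i := by
  have h1 := nextInBlock_mem (u := u) r (hk.trans hu)
  have h2 (i) := nextInBlock_le (l := l) (u := u) (k := i) r
  grind

theorem nextInBlock_eq_self_iff (h : IsSparseNoncrossing l u r) (hu : l < u) :
    nextInBlock l u r = u ↔ ∀ i, l < i → ¬ r l i := by
  have h1 := nextInBlock_mem r hu
  have h2 (i) := nextInBlock_le (l := l) (u := u) (k := i) r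
  have h3 (i) (hi : r l i) := (h.mem (h.symm hi)).2
  grind

theorem finite_setOf (l u : ℕ) : Finite {r // IsSparseNoncrossing l u r} := by
  refine Finite.of_injective
    (fun r (i j : Fin u) => r.1 i j : _ → Fin u → Fin u → Prop) fun r s h => ?_
  ext i j
  simp only [funext_iff, Fin.forall_iff] at h
  have h1 (hr : r.1 i j) := And.intro (r.2.mem hr).2 (r.2.mem (r.2.symm hr)).2
  have h2 (hr : s.1 i j) := And.intro (s.2.mem hr).2 (s.2.mem (s.2.symm hr)).2
  exact ⟨fun hr => h i (h1 hr).1 j (h1 hr).2 ▸ hr, fun hr => h i (h2 hr).1 j (h2 hr).2 ▸ hr⟩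

theorem card_add_right (l u s : ℕ) :
    Nat.card {r // IsSparseNoncrossing (l + s) (u + s) r} =
      Nat.card {r // IsSparseNoncrossing l u r} :=
  Nat.card_congr
    { toFun r := ⟨_, by simpa using r.2.shift (Nat.le_add_left s l)⟩
      invFun r := ⟨_, r.2.unshift s⟩
      left_inv r := by
        ext i j
        have h (hr : r.1 i j) := And.intro (r.2.mem hr).1 (r.2.mem (r.2.symm hr)).1
        change (s ≤ i ∧ s ≤ j ∧ r.1 (i - s + s) (j - s + s)) ↔ r.1 i j
        grind
      right_inv r := by ext i j; simp }

theorem card_nextInBlock_eq_self (hu : l < u) :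
    Nat.card {r : {r // IsSparseNoncrossing l u r} // nextInBlock l u r.1 = u} =
      Nat.card {r // IsSparseNoncrossing (l + 1) u r} :=
  Nat.card_congr
    { toFun r := ⟨_, r.1.2.restrict (Nat.le_succ l) le_rfl⟩
      invFun r := ⟨⟨_, r.2.addSingleton hu⟩, by
        have := @r.2.mem
        rw [nextInBlock_eq_self_iff (r.2.addSingleton hu) hu]
        grind⟩
      left_inv r := by
        ext i j
        have h := (nextInBlock_eq_self_iff r.1.2 hu).1 r.2
        have hm := @r.1.2.mem
        have hs := @r.1.2.symm
        have hr := @r.1.2.refl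
        grind
      right_inv r := by
        ext i j
        have hm := @r.2.mem
        have hs := @r.2.symm
        grind }

theorem card_nextInBlock_eq (hk : l + 2 ≤ k) (hu : k < u) :
    Nat.card {r : {r // IsSparseNoncrossing l u r} // nextInBlock l u r.1 = k} =
      Nat.card {r // IsSparseNoncrossing (l + 1) k r} *
        Nat.card {r // IsSparseNoncrossing k u r} := by
  rw [← Nat.card_prod]
  exact Nat.card_congr
    { toFun r := ⟨⟨_, r.1.2.restrict (Nat.le_succ l) hu.le⟩,
        ⟨_, r.1.2.restrict (show l ≤ k by lia) le_rfl⟩⟩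
      invFun r := ⟨⟨_, r.1.2.glue r.2.2 hk hu⟩, by
        have hm := @r.1.2.mem
        have hm' := @r.2.2.mem
        have hs' := @r.2.2.symm
        have hr' := @r.2.2.refl
        rw [nextInBlock_eq_iff _ (by lia) hu]
        grind⟩
      left_inv r := by
        ext i j
        obtain ⟨h1, h2⟩ := (nextInBlock_eq_iff r.1.1 (by lia) hu).1 r.2
        have hm := @r.1.2.mem
        have hs := @r.1.2.symm
        have hr := @r.1.2.refl
        have ht := @r.1.2.trans
        have hn (i j) := @r.1.2.noncrossing l i k j
        grind
      right_inv r := by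
        have hm := @r.1.2.mem
        have hs := @r.1.2.symm
        have hm' := @r.2.2.mem
        have hs' := @r.2.2.symm
        ext i j <;> grind }

theorem nextInBlock_ne_succ (h : IsSparseNoncrossing l u r) (hu : l + 1 < u) :
    nextInBlock l u r ≠ l + 1 := fun h' =>
  h.not_succ l ((nextInBlock_eq_iff r l.lt_succ_self hu).1 h').1

theorem card_add_two (n : ℕ) :
    Nat.card {r // IsSparseNoncrossing 0 (n + 2) r} =
      (∑ k ∈ Finset.range n, Nat.card {r // IsSparseNoncrossing 0 (k + 1) r} *
        Nat.card {r // IsSparseNoncrossing 0 (n - k) r}) +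
      Nat.card {r // IsSparseNoncrossing 0 (n + 1) r} := by
  have := finite_setOf 0 (n + 2)
  let f (r : {r // IsSparseNoncrossing 0 (n + 2) r}) : Fin (n + 3) :=
    ⟨nextInBlock 0 (n + 2) r.1,
      Nat.lt_succ_of_le (nextInBlock_le r.1 (Nat.succ_pos _) (.inl rfl))⟩
  have hf : Nat.card {r // IsSparseNoncrossing 0 (n + 2) r} = ∑ k ∈ Finset.range (n + 3),
      Nat.card {r : {r // IsSparseNoncrossing 0 (n + 2) r} // nextInBlock 0 (n + 2) r.1 = k} := by
    rw [← Nat.card_congr (Equiv.sigmaFiberEquiv f), Nat.card_sigma, Finset.sum_range]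
    simp only [f, Fin.ext_iff]
  rw [hf, Finset.sum_range_succ, Finset.sum_range_succ', Finset.sum_range_succ',
    card_nextInBlock_eq_self (Nat.succ_pos _), card_add_right 0 (n + 1) 1]
  have h0 : IsEmpty {r : {r // IsSparseNoncrossing 0 (n + 2) r} //
      nextInBlock 0 (n + 2) r.1 = 0} :=
    ⟨fun r => (nextInBlock_mem r.1.1 (Nat.succ_pos _)).1.ne' r.2⟩
  have h1 : IsEmpty {r : {r // IsSparseNoncrossing 0 (n + 2) r} //
      nextInBlock 0 (n + 2) r.1 = 0 + 1} :=
    ⟨fun r => nextInBlock_ne_succ r.1.2 (by lia) r.2⟩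
  rw [Nat.card_of_isEmpty, Nat.card_of_isEmpty, add_zero, add_zero]
  congr 1
  refine Finset.sum_congr rfl fun k hk => ?_
  rw [Finset.mem_range] at hk
  rw [card_nextInBlock_eq (by lia) (by lia), card_add_right 0 (k + 1) 1,
    ← card_add_right 0 (n - k) (k + 2), zero_add,
    show n - k + (k + 2) = n + 2 by lia]

theorem card_one : Nat.card {r // IsSparseNoncrossing 0 1 r} = 1 := by
  rw [Nat.card_eq_one_iff_unique]
  refine ⟨⟨fun r s => ?_⟩, ⟨⟨fun i j => i = 0 ∧ j = 0, by constructor <;> grind⟩⟩⟩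
  have key (r : {r // IsSparseNoncrossing 0 1 r}) (i j) : r.1 i j ↔ i = 0 ∧ j = 0 := by
    refine ⟨fun h => ?_, ?_⟩
    · have h1 := r.2.mem h
      have h2 := r.2.mem (r.2.symm h)
      lia
    · rintro ⟨rfl, rfl⟩
      exact r.2.refl le_rfl one_pos
  ext i j
  rw [key, key]

theorem card_eq_motzkin (n : ℕ) :
    Nat.card {r // IsSparseNoncrossing 0 (n + 1) r} = motzkin n := by
  induction n using Nat.strong_induction_on with
  | _ n ih =>
    match n with
    | 0 => simp [card_one, motzkin]
    | 1 => simp [card_add_two, card_one, motzkin]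
    | n + 2 =>
      rw [card_add_two, ih (n + 1) (by lia), motzkin_add_two, add_comm,
        Finset.Nat.sum_antidiagonal_eq_sum_range_succ fun i j => motzkin i * motzkin j]
      congr 1
      refine Finset.sum_congr rfl fun k hk => ?_
      rw [Finset.mem_range] at hk
      rw [ih k (by lia), show n + 1 - k = n - k + 1 by lia, ih (n - k) (by lia)]

end IsSparseNoncrossing

namespace Finpartition

variable {m : ℕ}

/-- The relation of lying in the same block of a partition of `{0,…,m-1}`, as a relation on `ℕ`. -/
def natRel (P : Finpartition (Finset.univ : Finset (Fin m))) (i j : ℕ) : Prop :=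
  ∃ (hi : i < m) (hj : j < m), (⟨i, hi⟩ : Fin m) ∈ P.part ⟨j, hj⟩

theorem natRel_coe (P : Finpartition (Finset.univ : Finset (Fin m))) (a b : Fin m) :
    P.natRel a b ↔ ∃ B ∈ P.parts, a ∈ B ∧ b ∈ B := by
  simp [natRel, mem_part_iff_exists]

theorem natRel_coe_iff_part_eq (P : Finpartition (Finset.univ : Finset (Fin m))) (a b : Fin m) :
    P.natRel a b ↔ P.part a = P.part b := by
  simp [natRel, mem_part_iff_part_eq_part]

theorem natRel_injective :
    Function.Injective (natRel : Finpartition (Finset.univ : Finset (Fin m)) → _) := by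
  intro P Q h
  have hpart (a : Fin m) : P.part a = Q.part a := by
    ext b
    have := congrFun₂ h b a
    simpa [natRel] using this
  ext B
  constructor
  · intro hB
    obtain ⟨a, -, rfl⟩ := P.part_surjOn hB
    rw [hpart]
    exact Q.part_mem.2 (Finset.mem_univ a)
  · intro hB
    obtain ⟨a, -, rfl⟩ := Q.part_surjOn hB
    rw [← hpart]
    exact P.part_mem.2 (Finset.mem_univ a)

theorem isSparseNoncrossing_natRel_iff (P : Finpartition (Finset.univ : Finset (Fin m))) :
    IsSparseNoncrossing 0 m P.natRel ↔ P.IsNoncrossing ∧ P.NoNearestNeighbor := by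
  constructor
  · refine fun h => ⟨fun a b c d hab hbc hcd hac hbd => ?_, fun B hB i j hij hB' => ?_⟩
    · rw [← natRel_coe] at hac hbd
      have hn := h.noncrossing hab hbc hcd hac hbd
      rw [natRel_coe_iff_part_eq] at hac hbd hn
      refine ⟨P.part a, P.part_mem.2 (Finset.mem_univ a), ?_⟩
      simp only [mem_part_iff_part_eq_part _ (Finset.mem_univ _) (Finset.mem_univ _)]
      exact ⟨trivial, hn.symm, hac.symm, (hn.trans hbd).symm⟩
    · refine h.not_succ i ?_
      rw [hij]
      exact (P.natRel_coe i j).2 ⟨B, hB, hB'⟩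
  · rintro ⟨hc, hs⟩
    refine ⟨?_, ?_, ?_, ?_, ?_, ?_⟩
    · rintro i j ⟨hi, -⟩
      exact ⟨Nat.zero_le i, hi⟩
    · exact fun {i} _ hi => (P.natRel_coe_iff_part_eq ⟨i, hi⟩ ⟨i, hi⟩).2 rfl
    · rintro i j h
      obtain ⟨hi, hj, -⟩ := id h
      exact (P.natRel_coe_iff_part_eq ⟨j, hj⟩ ⟨i, hi⟩).2
        ((P.natRel_coe_iff_part_eq ⟨i, hi⟩ ⟨j, hj⟩).1 h).symm
    · rintro i j k h h'
      obtain ⟨hi, hj, -⟩ := id h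
      obtain ⟨-, hk, -⟩ := id h'
      exact (P.natRel_coe_iff_part_eq ⟨i, hi⟩ ⟨k, hk⟩).2
        (((P.natRel_coe_iff_part_eq ⟨i, hi⟩ ⟨j, hj⟩).1 h).trans
          ((P.natRel_coe_iff_part_eq ⟨j, hj⟩ ⟨k, hk⟩).1 h'))
    · rintro a b c d hab hbc hcd h h'
      obtain ⟨ha, hc', -⟩ := id h
      obtain ⟨hb, hd, -⟩ := id h'
      obtain ⟨B, hB, haB, hbB, -⟩ := hc ⟨a, ha⟩ ⟨b, hb⟩ ⟨c, hc'⟩ ⟨d, hd⟩ hab hbc hcd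
        ((P.natRel_coe _ _).1 h) ((P.natRel_coe _ _).1 h')
      exact (P.natRel_coe ⟨a, ha⟩ ⟨b, hb⟩).2 ⟨B, hB, haB, hbB⟩
    · rintro i h
      obtain ⟨hi, hj, -⟩ := id h
      obtain ⟨B, hB, hB'⟩ := (P.natRel_coe ⟨i, hi⟩ ⟨i + 1, hj⟩).1 h
      exact hs B hB _ _ rfl hB'

theorem exists_natRel_eq {r : ℕ → ℕ → Prop} (h : IsSparseNoncrossing 0 m r) :
    ∃ P : Finpartition (Finset.univ : Finset (Fin m)), P.natRel = r := by
  classical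
  let s : Setoid (Fin m) :=
    ⟨fun a b => r a b, fun a => h.refl (Nat.zero_le _) a.2, h.symm, h.trans⟩
  refine ⟨ofSetoid s, ?_⟩
  ext i j
  simp only [natRel, mem_part_ofSetoid_iff_rel]
  refine ⟨fun ⟨_, _, hr⟩ => h.symm hr, fun hr => ?_⟩
  exact ⟨(h.mem hr).2, (h.mem (h.symm hr)).2, h.symm hr⟩

theorem card_isNoncrossing_and_noNearestNeighbor (m : ℕ) :
    Nat.card {P : Finpartition (Finset.univ : Finset (Fin m)) //
        P.IsNoncrossing ∧ P.NoNearestNeighbor} =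
      Nat.card {r // IsSparseNoncrossing 0 m r} := by
  refine Nat.card_congr (Equiv.ofBijective
    (fun P => ⟨P.1.natRel, P.1.isSparseNoncrossing_natRel_iff.2 P.2⟩) ⟨fun P Q h => ?_, ?_⟩)
  · exact Subtype.ext (natRel_injective (congrArg Subtype.val h))
  · rintro ⟨r, hr⟩
    obtain ⟨P, rfl⟩ := exists_natRel_eq hr
    exact ⟨⟨P, P.isSparseNoncrossing_natRel_iff.1 hr⟩, rfl⟩

end Finpartition

/-- The number of non-crossing partitions of `{0,…,m-1}` with no block containing two
consecutive integers is the Motzkin number `M_{m-1}`. -/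
theorem card_noncrossing_nnn_partitions_eq_motzkin (m : ℕ) (hm : 1 ≤ m) :
    Nat.card {P : Finpartition (Finset.univ : Finset (Fin m)) //
        P.IsNoncrossing ∧ P.NoNearestNeighbor} = motzkin (m - 1) := by
  rw [Finpartition.card_isNoncrossing_and_noNearestNeighbor,
    ← IsSparseNoncrossing.card_eq_motzkin, Nat.sub_add_cancel hm]
end
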